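/- Let n,m ≥ 1, let p_1,…,p_n > 0 with Σ_i p_i = 1, let r_{ij} ≥ 0 and b_{ij} > 0, let c_1,…,c_m ≥ 0, let T ≥ 1, and let ν_1,…,ν_n be Borel probability measures on (0,∞) with finite mean. For c̃ ∈ [0,∞)^m and i ∈ {1,…,n}, define G_i(c̃) as the supremum, over Borel measurable x_j : (0,∞) → [0,1] (1 ≤ j ≤ m) with Σ_{j=1}^m x_j(u) ≤ 1 for all u and T·p_i·b_{ij}·∫ u·x_j(u) dν_i(u) ≤ c̃_j for every j, of T·p_i·∫ Σ_{j=1}^m r_{ij}·x_j(u) dν_i(u). Define LP^UB as the supremum, over families of Borel measurable x_{ij} : (0,∞) → [0,1] with Σ_{j=1}^m x_{ij}(u) ≤ 1 for every i and u, and T·Σ_{i=1}^n p_i·b_{ij}·∫ u·x_{ij}(u) dν_i(u) ≤ c_j for every j, of T·Σ_{i=1}^n p_i·∫ Σ_{j=1}^m r_{ij}·x_{ij}(u) dν_i(u). Then LP^UB = sup{ Σ_{i=1}^n G_i(c̃_i) : c̃_1,…,c̃_n ∈ [0,∞)^m and Σ_{i=1}^n (c̃_i)_j ≤ c_j for every j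 }. -/

import Mathlib

open MeasureTheory

/-- The value `G_i(c̃)` of the single-type sub-LP with per-type capacities `c̃`. -/
noncomputable def subLP {m : ℕ} (T' pi : ℝ) (νi : MeasureTheory.Measure ℝ)
    (ri bi : Fin m → ℝ) (ct : Fin m → ℝ) : ℝ :=
  sSup {v : ℝ | ∃ x : Fin m → ℝ → ℝ,
    (∀ j, Measurable (x j)) ∧
    (∀ j w, x j w ∈ Set.Icc (0:ℝ) 1) ∧
    (∀ w, ∑ j, x j w ≤ 1) ∧
    (∀ j, T' * pi * bi j * ∫ w, w * x j w ∂νi ≤ ct j) ∧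
    v = T' * pi * ∫ w, ∑ j, ri j * x j w ∂νi}

/-- The feasible value set of the single-type sub-LP. -/
lemma sub_val_bound {m : ℕ} (t : ℝ) (ht : 0 ≤ t) (μ : Measure ℝ) (hμ : IsProbabilityMeasure μ)
    (r : Fin m → ℝ) (hr : ∀ j, 0 ≤ r j) (x : Fin m → ℝ → ℝ)
    (hx : ∀ j w, x j w ∈ Set.Icc (0:ℝ) 1) :
    t * ∫ w, ∑ j, r j * x j w ∂μ ≤ t * ∑ j, r j := by
  apply mul_le_mul_of_nonneg_left _ ht
  have h := integral_mono_of_nonneg (μ := μ) (f := fun w => ∑ j, r j * x j w)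
    (g := fun _ => ∑ j, r j)
    (Filter.Eventually.of_forall fun w =>
      Finset.sum_nonneg fun j _ => mul_nonneg (hr j) (hx j w).1)
    (integrable_const _)
    (Filter.Eventually.of_forall fun w =>
      Finset.sum_le_sum fun j _ => mul_le_of_le_one_right (hr j) (hx j w).2)
  simpa using h

/-- decomposition of the LP prophet upper bound: the full LP equals the
optimal splitting of each resource capacity into per-type capacities, summing the
single-type sub-LP values `G_i`. -/
theorem stmt4
    {n m : ℕ} (hn : 1 ≤ n) (hm : 1 ≤ m)
    (p : Fin n → ℝ) (hp : ∀ i, 0 < p i) (hpsum : ∑ i, p i = 1)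
    (r : Fin n → Fin m → ℝ) (hr : ∀ i j, 0 ≤ r i j)
    (b : Fin n → Fin m → ℝ) (hb : ∀ i j, 0 < b i j)
    (c : Fin m → ℝ) (hc : ∀ j, 0 ≤ c j)
    (T : ℕ) (hT : 1 ≤ T)
    (ν : Fin n → Measure ℝ) (hprob : ∀ i, IsProbabilityMeasure (ν i))
    (hsupp : ∀ i, (ν i) (Set.Iic 0) = 0)
    (hmean : ∀ i, Integrable (fun v : ℝ => v) (ν i)) :
    sSup {v : ℝ | ∃ x : Fin n → Fin m → ℝ → ℝ,
        (∀ i j, Measurable (x i j)) ∧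
        (∀ i j w, x i j w ∈ Set.Icc (0:ℝ) 1) ∧
        (∀ i w, ∑ j, x i j w ≤ 1) ∧
        (∀ j, (T : ℝ) * ∑ i, p i * b i j * ∫ w, w * x i j w ∂(ν i) ≤ c j) ∧
        v = (T : ℝ) * ∑ i, p i * ∫ w, ∑ j, r i j * x i j w ∂(ν i)}
      = sSup {v : ℝ | ∃ ct : Fin n → Fin m → ℝ,
          (∀ i j, 0 ≤ ct i j) ∧
          (∀ j, ∑ i, ct i j ≤ c j) ∧
          v = ∑ i, subLP (T : ℝ) (p i) (ν i) (r i) (b i) (ct i)} := by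
  have hT0 : (0:ℝ) ≤ T := Nat.cast_nonneg T
  have htp : ∀ i, 0 ≤ (T:ℝ) * p i := fun i => mul_nonneg hT0 (hp i).le
  have hbdd : ∀ i (ct : Fin m → ℝ), ∀ v ∈ {v : ℝ | ∃ x : Fin m → ℝ → ℝ,
      (∀ j, Measurable (x j)) ∧ (∀ j w, x j w ∈ Set.Icc (0:ℝ) 1) ∧ (∀ w, ∑ j, x j w ≤ 1) ∧
      (∀ j, (T:ℝ) * p i * b i j * ∫ w, w * x j w ∂(ν i) ≤ ct j) ∧
      v = (T:ℝ) * p i * ∫ w, ∑ j, r i j * x j w ∂(ν i)}, v ≤ (T:ℝ) * p i * ∑ j, r i j := by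
    rintro i ct v ⟨x, -, hx, -, -, rfl⟩
    exact sub_val_bound _ (htp i) _ (hprob i) _ (hr i) x hx
  have hne : ∀ i (ct : Fin m → ℝ), (∀ j, 0 ≤ ct j) → {v : ℝ | ∃ x : Fin m → ℝ → ℝ,
      (∀ j, Measurable (x j)) ∧ (∀ j w, x j w ∈ Set.Icc (0:ℝ) 1) ∧ (∀ w, ∑ j, x j w ≤ 1) ∧
      (∀ j, (T:ℝ) * p i * b i j * ∫ w, w * x j w ∂(ν i) ≤ ct j) ∧
      v = (T:ℝ) * p i * ∫ w, ∑ j, r i j * x j w ∂(ν i)}.Nonempty := by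
    intro i ct hct
    exact ⟨_, fun _ _ => 0, fun _ => measurable_const, by simp, by simp, by simpa using hct, rfl⟩
  have hle : ∀ i (ct : Fin m → ℝ), (∀ j, 0 ≤ ct j) →
      subLP (T:ℝ) (p i) (ν i) (r i) (b i) ct ≤ (T:ℝ) * p i * ∑ j, r i j :=
    fun i ct hct => csSup_le (hne i ct hct) (hbdd i ct)
  apply le_antisymm
  · apply csSup_le
    · exact ⟨_, fun _ _ _ => 0, fun _ _ => measurable_const, by simp, by simp,
        by simpa using hc, rfl⟩
    · rintro v ⟨x, hxm, hx, hx1, hxc, rfl⟩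
      have hct : ∀ i j, 0 ≤ (T:ℝ) * p i * b i j * ∫ w, w * x i j w ∂(ν i) := by
        intro i j
        apply mul_nonneg (mul_nonneg (htp i) (hb i j).le)
        apply integral_nonneg_of_ae
        have h0 : ∀ᵐ w ∂(ν i), w ∉ Set.Iic (0:ℝ) := measure_eq_zero_iff_ae_notMem.1 (hsupp i)
        filter_upwards [h0] with w hw
        exact mul_nonneg (not_le.1 hw).le (hx i j w).1
      refine le_trans ?_ (le_csSup ?_
        ⟨fun i j => (T:ℝ) * p i * b i j * ∫ w, w * x i j w ∂(ν i), hct, ?_, rfl⟩)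
      · rw [Finset.mul_sum]
        refine Finset.sum_le_sum fun i _ => ?_
        rw [← mul_assoc]
        exact le_csSup ⟨_, hbdd i _⟩ ⟨x i, hxm i, hx i, hx1 i, fun j => le_rfl, rfl⟩
      · refine ⟨∑ i, (T:ℝ) * p i * ∑ j, r i j, ?_⟩
        rintro v ⟨ct, h0, -, rfl⟩
        exact Finset.sum_le_sum fun i _ => hle i _ (h0 i)
      · intro j
        refine le_trans (le_of_eq ?_) (hxc j)
        rw [Finset.mul_sum]
        exact Finset.sum_congr rfl fun i _ => by ring
  · apply csSup_le
    · exact ⟨_, fun _ _ => 0, by simp, by simpa using hc, rfl⟩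
    · rintro v ⟨ct, h0, hcs, rfl⟩
      apply le_of_forall_pos_le_add
      intro ε hε
      have hn0 : (0:ℝ) < n := by exact_mod_cast hn
      have key := fun i => exists_lt_of_lt_csSup (hne i (ct i) (h0 i))
        (sub_lt_self (subLP (T:ℝ) (p i) (ν i) (r i) (b i) (ct i)) (div_pos hε hn0))
      choose v hv hlt using key
      choose x hxm hx hx1 hxc hxv using hv
      have h1 : ∑ i, v i ≤ sSup {v : ℝ | ∃ x : Fin n → Fin m → ℝ → ℝ,
        (∀ i j, Measurable (x i j)) ∧
        (∀ i j w, x i j w ∈ Set.Icc (0:ℝ) 1) ∧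
        (∀ i w, ∑ j, x i j w ≤ 1) ∧
        (∀ j, (T : ℝ) * ∑ i, p i * b i j * ∫ w, w * x i j w ∂(ν i) ≤ c j) ∧
        v = (T : ℝ) * ∑ i, p i * ∫ w, ∑ j, r i j * x i j w ∂(ν i)} := by
        apply le_csSup
        · refine ⟨∑ i, (T:ℝ) * p i * ∑ j, r i j, ?_⟩
          rintro v ⟨x, -, hx, -, -, rfl⟩
          rw [Finset.mul_sum]
          refine Finset.sum_le_sum fun i _ => ?_
          rw [← mul_assoc]
          exact sub_val_bound _ (htp i) _ (hprob i) _ (hr i) _ (hx i)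
        · refine ⟨x, hxm, hx, hx1, fun j => ?_, ?_⟩
          · refine le_trans ?_ (hcs j)
            rw [Finset.mul_sum]
            refine Finset.sum_le_sum fun i _ => le_trans (le_of_eq ?_) (hxc i j)
            ring
          · rw [Finset.mul_sum]
            exact Finset.sum_congr rfl fun i _ => by rw [hxv i, mul_assoc]
      have h2 : ∑ i, subLP (T:ℝ) (p i) (ν i) (r i) (b i) (ct i) ≤ ∑ i, (v i + ε / n) :=
        Finset.sum_le_sum fun i _ => by linarith [hlt i]
      have h3 : ∑ i : Fin n, (v i + ε / n) = ∑ i, v i + ε := by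
        rw [Finset.sum_add_distrib]
        simp
        field_simp
      linarith
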